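/- For a PI-algebra A over a field of characteristic zero, the codimension sequence c_n(A) and proper codimension sequence γ_n(A) satisfy c_n(A) = Σ_{l=0}^{n} C(n,l) γ_l(A). -/

import Mathlib

noncomputable section

/-- The commutator `[a,b] = ab - ba` in a ring. -/
def rcomm {A : Type*} [Ring A] (a b : A) : A := a * b - b * a

variable (K : Type*) [Field K]

/-- The T-ideal of polynomial identities of `A`, as a subspace of the free unital
associative algebra `K⟨x_0, x_1, ...⟩`: the polynomials vanishing under every
substitution, i.e. under every algebra homomorphism to `A`. -/
def Tideal (A : Type*) [Ring A] [Algebra K A] : Submodule K (FreeAlgebra K ℕ) :=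
  ⨅ φ : FreeAlgebra K ℕ →ₐ[K] A, LinearMap.ker φ.toLinearMap

/-- The multilinear monomial `x_{σ(0)} x_{σ(1)} ⋯ x_{σ(n-1)}`. -/
def permMonomial (n : ℕ) (σ : Equiv.Perm (Fin n)) : FreeAlgebra K ℕ :=
  (List.ofFn fun i => FreeAlgebra.ι K ((σ i : Fin n) : ℕ)).prod

/-- `P_n`: the space of multilinear polynomials of degree `n` in `x_0, ..., x_{n-1}`. -/
def Pspace (n : ℕ) : Submodule K (FreeAlgebra K ℕ) :=
  Submodule.span K {w | ∃ σ : Equiv.Perm (Fin n), w = permMonomial K n σ}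

/-- The left-normed pure commutator `[x_a, x_{l_0}, x_{l_1}, ...]` of variables. -/
def varComm (a : ℕ) (l : List ℕ) : FreeAlgebra K ℕ :=
  l.foldl (fun w i => rcomm w (FreeAlgebra.ι K i)) (FreeAlgebra.ι K a)

/-- The space of proper polynomials: linear combinations of products of pure commutators
(of length at least 2), i.e. the unital subalgebra generated by all pure commutators. -/
def properSubalgebra : Subalgebra K (FreeAlgebra K ℕ) :=
  Algebra.adjoin K {w | ∃ (a : ℕ) (l : List ℕ), l ≠ [] ∧ w = varComm K a l}

/-- `Γ_n`: the space of proper multilinear polynomials of degree `n`. -/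
def Gspace (n : ℕ) : Submodule K (FreeAlgebra K ℕ) :=
  Pspace K n ⊓ Subalgebra.toSubmodule (properSubalgebra K)

/-- The `n`-th codimension `c_n(A) = dim P_n/(P_n ∩ T(A))`. -/
def codim (A : Type*) [Ring A] [Algebra K A] (n : ℕ) : ℕ :=
  Module.finrank K (↥(Pspace K n) ⧸ (Tideal K A).comap (Pspace K n).subtype)

/-- The `n`-th proper codimension `γ_n(A) = dim Γ_n/(Γ_n ∩ T(A))`. -/
def properCodim (A : Type*) [Ring A] [Algebra K A] (n : ℕ) : ℕ :=
  Module.finrank K (↥(Gspace K n) ⧸ (Tideal K A).comap (Gspace K n).subtype)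

open Finset

section Substitutions

/-- The multilinear polynomials in the variables indexed by `S`. -/
def multilin (S : Finset ℕ) : Submodule K (FreeAlgebra K ℕ) :=
  Submodule.span K {w | ∃ l : List ℕ, l.Nodup ∧ l.toFinset = S ∧
    w = (l.map (FreeAlgebra.ι K)).prod}

/-- The substitution `x_i ↦ x_i + 1`. -/
def shift (i : ℕ) : FreeAlgebra K ℕ →ₐ[K] FreeAlgebra K ℕ :=
  FreeAlgebra.lift K fun j => FreeAlgebra.ι K j + if j = i then 1 else 0

/-- The difference operator `f ↦ f(x_i + 1) - f(x_i)`. -/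
def diff (i : ℕ) : FreeAlgebra K ℕ →ₗ[K] FreeAlgebra K ℕ :=
  (shift K i).toLinearMap - LinearMap.id

/-- The substitution `x_i ↦ x_{g(i)}`. -/
def rename (g : ℕ → ℕ) : FreeAlgebra K ℕ →ₐ[K] FreeAlgebra K ℕ :=
  FreeAlgebra.lift K fun j => FreeAlgebra.ι K (g j)

variable {K}

@[simp] lemma shift_ι (i j : ℕ) :
    shift K i (FreeAlgebra.ι K j) = FreeAlgebra.ι K j + if j = i then 1 else 0 := by
  simp [shift]

@[simp] lemma rename_ι (g : ℕ → ℕ) (j : ℕ) :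
    rename K g (FreeAlgebra.ι K j) = FreeAlgebra.ι K (g j) := by
  simp [rename]

lemma diff_apply (i : ℕ) (f : FreeAlgebra K ℕ) : diff K i f = shift K i f - f := rfl

lemma diff_eq_zero_iff {i : ℕ} {f : FreeAlgebra K ℕ} : diff K i f = 0 ↔ shift K i f = f := by
  rw [diff_apply, sub_eq_zero]

lemma shift_comm (i j : ℕ) (f : FreeAlgebra K ℕ) :
    shift K i (shift K j f) = shift K j (shift K i f) := by
  have h : (shift K i).comp (shift K j) = (shift K j).comp (shift K i) := by
    ext k
    simp only [Function.comp_apply, AlgHom.coe_comp, shift_ι, map_add]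
    split_ifs <;> simp [add_comm]
  exact DFunLike.congr_fun h f

lemma diff_comm (i j : ℕ) (f : FreeAlgebra K ℕ) :
    diff K i (diff K j f) = diff K j (diff K i f) := by
  simp only [diff_apply, map_sub, shift_comm i j]
  abel

lemma diff_ι_mul_of_ne {i j : ℕ} (h : j ≠ i) (f : FreeAlgebra K ℕ) :
    diff K i (FreeAlgebra.ι K j * f) = FreeAlgebra.ι K j * diff K i f := by
  simp [diff_apply, h, mul_sub]

lemma diff_ι_mul_self {i : ℕ} {f : FreeAlgebra K ℕ} (h : diff K i f = 0) :
    diff K i (FreeAlgebra.ι K i * f) = f := by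
  simp [diff_apply, diff_eq_zero_iff.1 h, add_mul]

lemma shift_word {i : ℕ} {l : List ℕ} (h : i ∉ l) :
    shift K i (l.map (FreeAlgebra.ι K)).prod = (l.map (FreeAlgebra.ι K)).prod := by
  induction l with
  | nil => simp
  | cons a l ih =>
    rw [List.mem_cons, not_or] at h
    simp [ih h.2, Ne.symm h.1]

lemma diff_eq_zero_of_mem_multilin {i : ℕ} {S : Finset ℕ} (hi : i ∉ S) {f : FreeAlgebra K ℕ}
    (hf : f ∈ multilin K S) : diff K i f = 0 := by
  have h : multilin K S ≤ LinearMap.ker (diff K i) := by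
    refine Submodule.span_le.2 ?_
    rintro _ ⟨l, -, rfl, rfl⟩
    exact diff_eq_zero_iff.2 (shift_word (by simpa using hi))
  exact h hf

lemma diff_mem_multilin {i : ℕ} {S : Finset ℕ} (hi : i ∈ S) {f : FreeAlgebra K ℕ}
    (hf : f ∈ multilin K S) : diff K i f ∈ multilin K (S.erase i) := by
  have h : multilin K S ≤ (multilin K (S.erase i)).comap (diff K i) := by
    refine Submodule.span_le.2 ?_
    rintro _ ⟨l, hl, rfl, rfl⟩
    obtain ⟨u, v, rfl⟩ := List.append_of_mem (List.mem_toFinset.1 hi)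
    rw [List.nodup_middle, List.nodup_cons] at hl
    have hu : i ∉ u := fun h => hl.1 (by simp [h])
    have hv : i ∉ v := fun h => hl.1 (by simp [h])
    refine Submodule.subset_span ⟨u ++ v, hl.2, ?_, ?_⟩
    · ext k
      by_cases hk : k = i
      · subst hk
        simp [hu, hv]
      · simp [hk]
    · simp [diff_apply, shift_word hu, shift_word hv, add_mul, mul_add]
  exact h hf

lemma ι_mul_mem_multilin {i : ℕ} {S : Finset ℕ} (hi : i ∉ S) {f : FreeAlgebra K ℕ}
    (hf : f ∈ multilin K S) : FreeAlgebra.ι K i * f ∈ multilin K (insert i S) := by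
  have h : multilin K S ≤
      (multilin K (insert i S)).comap (LinearMap.mulLeft K (FreeAlgebra.ι K i)) := by
    refine Submodule.span_le.2 ?_
    rintro _ ⟨l, hl, rfl, rfl⟩
    exact Submodule.subset_span
      ⟨i :: l, List.nodup_cons.2 ⟨by simpa using hi, hl⟩, by simp, by simp⟩
  exact h hf

lemma rename_mem_multilin {g : ℕ → ℕ} {S : Finset ℕ} (hg : Set.InjOn g S)
    {f : FreeAlgebra K ℕ} (hf : f ∈ multilin K S) :
    rename K g f ∈ multilin K (S.image g) := by
  have h : multilin K S ≤ (multilin K (S.image g)).comap (rename K g).toLinearMap := by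
    refine Submodule.span_le.2 ?_
    rintro _ ⟨l, hl, rfl, rfl⟩
    refine Submodule.subset_span ⟨l.map g, ?_, ?_, ?_⟩
    · exact hl.map_on fun x hx y hy => hg (by simpa using hx) (by simpa using hy)
    · ext k; simp
    · simp [map_list_prod, Function.comp_def]
  exact h hf

lemma rename_rename_of_mem_multilin {g h : ℕ → ℕ} {S : Finset ℕ} (hg : ∀ i ∈ S, g (h i) = i)
    {f : FreeAlgebra K ℕ} (hf : f ∈ multilin K S) : rename K g (rename K h f) = f := by
  have H : multilin K S ≤ LinearMap.ker
      ((rename K g).toLinearMap ∘ₗ (rename K h).toLinearMap - LinearMap.id) := by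
    refine Submodule.span_le.2 ?_
    rintro _ ⟨l, hl, rfl, rfl⟩
    simp only [SetLike.mem_coe, LinearMap.mem_ker, LinearMap.sub_apply, sub_eq_zero,
      LinearMap.comp_apply, AlgHom.toLinearMap_apply, LinearMap.id_apply, map_list_prod,
      List.map_map]
    congr 1
    refine List.map_congr_left fun x hx => ?_
    simp [hg x (by simpa using hx)]
  exact sub_eq_zero.1 (H hf)

instance (S : Finset ℕ) : FiniteDimensional K (multilin K S) := by
  refine FiniteDimensional.span_of_finite K ?_
  refine (Set.Finite.image (fun l : List ℕ => (l.map (FreeAlgebra.ι K)).prod)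
    (List.finite_toSet S.toList.permutations)).subset ?_
  rintro _ ⟨l, hl, rfl, rfl⟩
  refine ⟨l, ?_, rfl⟩
  simp only [Set.mem_ofPred_eq, List.mem_permutations]
  rw [List.perm_ext_iff_of_nodup hl (nodup_toList _)]
  simp

lemma Pspace_eq_multilin (n : ℕ) : Pspace K n = multilin K (range n) := by
  refine le_antisymm (Submodule.span_le.2 ?_) (Submodule.span_le.2 ?_)
  · rintro _ ⟨σ, rfl⟩
    refine Submodule.subset_span ⟨List.ofFn fun i => (σ i : ℕ), ?_, ?_, ?_⟩
    · exact List.nodup_ofFn.2 (Fin.val_injective.comp σ.injective)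
    · ext k
      simp only [List.mem_toFinset, List.mem_ofFn, mem_range]
      exact ⟨by rintro ⟨i, rfl⟩; exact (σ i).2, fun hk => ⟨σ.symm ⟨k, hk⟩, by simp⟩⟩
    · simp [permMonomial, List.map_ofFn, Function.comp_def]
  · rintro _ ⟨l, hl, hn, rfl⟩
    have hlen : l.length = n := by
      rw [← List.toFinset_card_of_nodup hl, hn, card_range]
    subst hlen
    have hlt (i : Fin l.length) : l.get i < l.length := by
      rw [← mem_range, ← hn]; simp
    have hinj : Function.Injective fun i : Fin l.length => (⟨l.get i, hlt i⟩ : Fin l.length) :=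
      fun i j h => List.nodup_iff_injective_get.1 hl (congrArg Fin.val h)
    refine Submodule.subset_span
      ⟨Equiv.ofBijective _ (Finite.injective_iff_bijective.1 hinj), ?_⟩
    conv_lhs => rw [← List.ofFn_get l]
    simp only [permMonomial, List.map_ofFn, Function.comp_def, Equiv.ofBijective_apply]

end Substitutions

section Proper

variable {K}

lemma varComm_append (a : ℕ) (l : List ℕ) (i : ℕ) :
    varComm K a (l ++ [i]) = rcomm (varComm K a l) (FreeAlgebra.ι K i) := by
  simp [varComm]

lemma rcomm_mem_properSubalgebra {p : FreeAlgebra K ℕ} (hp : p ∈ properSubalgebra K) (i : ℕ) :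
    rcomm p (FreeAlgebra.ι K i) ∈ properSubalgebra K := by
  induction hp using Algebra.adjoin_induction with
  | mem w hw =>
    obtain ⟨a, l, -, rfl⟩ := hw
    exact Algebra.subset_adjoin ⟨a, l ++ [i], by simp, (varComm_append a l i).symm⟩
  | algebraMap r =>
    simp [rcomm, Algebra.commutes r]
  | add x y _ _ hx hy =>
    have h : rcomm (x + y) (FreeAlgebra.ι K i) =
        rcomm x (FreeAlgebra.ι K i) + rcomm y (FreeAlgebra.ι K i) := by
      simp only [rcomm]; noncomm_ring
    exact h ▸ add_mem hx hy
  | mul x y hx hy hx' hy' =>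
    have h : rcomm (x * y) (FreeAlgebra.ι K i) =
        x * rcomm y (FreeAlgebra.ι K i) + rcomm x (FreeAlgebra.ι K i) * y := by
      simp only [rcomm]; noncomm_ring
    exact h ▸ add_mem (mul_mem hx hy') (mul_mem hx' hy)

lemma shift_varComm (i a : ℕ) (l : List ℕ) :
    ∃ c : K, shift K i (varComm K a l) = varComm K a l + algebraMap K _ c ∧
      (l ≠ [] → c = 0) := by
  induction l using List.reverseRecOn with
  | nil => exact ⟨if a = i then 1 else 0, by simp [varComm, apply_ite (algebraMap K _)], by simp⟩
  | append_singleton l b ih =>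
    obtain ⟨c, hc, -⟩ := ih
    refine ⟨0, ?_, fun _ => rfl⟩
    simp only [varComm_append, rcomm, map_sub, map_mul, hc, shift_ι, map_zero, add_zero]
    have := Algebra.commutes c (FreeAlgebra.ι K b)
    split_ifs <;> simp only [add_mul, mul_add, this, mul_one, one_mul, add_zero] <;> abel

lemma shift_of_mem_properSubalgebra (i : ℕ) {p : FreeAlgebra K ℕ}
    (hp : p ∈ properSubalgebra K) : shift K i p = p := by
  have h : properSubalgebra K ≤ AlgHom.equalizer (shift K i) (AlgHom.id K _) := by
    refine Algebra.adjoin_le ?_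
    rintro _ ⟨a, l, hl, rfl⟩
    obtain ⟨c, hc, hc'⟩ := shift_varComm (K := K) i a l
    simp [hc, hc' hl]
  exact h hp

lemma rename_varComm (g : ℕ → ℕ) (a : ℕ) (l : List ℕ) :
    rename K g (varComm K a l) = varComm K (g a) (l.map g) := by
  induction l using List.reverseRecOn with
  | nil => simp [varComm]
  | append_singleton l b ih => simp [varComm_append, rcomm, ih]

lemma rename_mem_properSubalgebra (g : ℕ → ℕ) {p : FreeAlgebra K ℕ}
    (hp : p ∈ properSubalgebra K) : rename K g p ∈ properSubalgebra K := by
  have h : properSubalgebra K ≤ (properSubalgebra K).comap (rename K g) := by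
    refine Algebra.adjoin_le ?_
    rintro _ ⟨a, l, hl, rfl⟩
    exact Algebra.subset_adjoin ⟨g a, l.map g, by simpa using hl, rename_varComm g a l⟩
  exact h hp

variable (K) in
/-- The span of the products `x_{i_1} ⋯ x_{i_k} p` with `i_1, ..., i_k` a sublist of the given
list and `p` a proper polynomial. -/
def orderedSpan : List ℕ → Submodule K (FreeAlgebra K ℕ)
  | [] => Subalgebra.toSubmodule (properSubalgebra K)
  | i :: L => orderedSpan L ⊔ (orderedSpan L).map (LinearMap.mulLeft K (FreeAlgebra.ι K i))

lemma mem_orderedSpan_cons {i : ℕ} {L : List ℕ} {f : FreeAlgebra K ℕ} :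
    f ∈ orderedSpan K (i :: L) ↔
      ∃ a ∈ orderedSpan K L, ∃ b ∈ orderedSpan K L, a + FreeAlgebra.ι K i * b = f := by
  simp [orderedSpan, Submodule.mem_sup]

lemma orderedSpan_le_cons (i : ℕ) (L : List ℕ) : orderedSpan K L ≤ orderedSpan K (i :: L) :=
  le_sup_left

lemma one_mem_orderedSpan (L : List ℕ) : (1 : FreeAlgebra K ℕ) ∈ orderedSpan K L := by
  induction L with
  | nil => exact one_mem (properSubalgebra K)
  | cons i L ih => exact orderedSpan_le_cons i L ih

lemma orderedSpan_erase_le (i : ℕ) (L : List ℕ) :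
    orderedSpan K (L.erase i) ≤ orderedSpan K L := by
  induction L with
  | nil => simp
  | cons j L ih =>
    by_cases h : j = i
    · subst h
      simpa using orderedSpan_le_cons j L
    · rw [List.erase_cons_tail (by simpa using h)]
      exact sup_le_sup ih (Submodule.map_mono ih)

lemma proper_mul_mem_orderedSpan {L : List ℕ} {p f : FreeAlgebra K ℕ}
    (hp : p ∈ properSubalgebra K) (hf : f ∈ orderedSpan K L) : p * f ∈ orderedSpan K L := by
  induction L generalizing p f with
  | nil => exact mul_mem (S := Subalgebra K (FreeAlgebra K ℕ)) hp hf
  | cons i L ih =>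
    obtain ⟨a, ha, b, hb, rfl⟩ := mem_orderedSpan_cons.1 hf
    refine mem_orderedSpan_cons.2 ⟨p * a + rcomm p (FreeAlgebra.ι K i) * b,
      add_mem (ih hp ha) (ih (rcomm_mem_properSubalgebra hp i) hb), p * b, ih hp hb, ?_⟩
    simp only [rcomm]; noncomm_ring

lemma ι_mul_mem_orderedSpan {j : ℕ} {L : List ℕ} (hj : j ∈ L) {f : FreeAlgebra K ℕ}
    (hf : f ∈ orderedSpan K (L.erase j)) : FreeAlgebra.ι K j * f ∈ orderedSpan K L := by
  induction L generalizing f with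
  | nil => simp at hj
  | cons i L ih =>
    by_cases h : i = j
    · subst h
      rw [List.erase_cons_head] at hf
      exact mem_orderedSpan_cons.2 ⟨0, zero_mem _, f, hf, zero_add _⟩
    · rw [List.erase_cons_tail (by simpa using h)] at hf
      have hjL : j ∈ L := (List.mem_cons.1 hj).resolve_left (Ne.symm h)
      obtain ⟨a, ha, b, hb, rfl⟩ := mem_orderedSpan_cons.1 hf
      have hc : rcomm (FreeAlgebra.ι K j) (FreeAlgebra.ι K i) ∈ properSubalgebra K :=
        Algebra.subset_adjoin ⟨j, [i], by simp, by simp [varComm]⟩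
      refine mem_orderedSpan_cons.2
        ⟨FreeAlgebra.ι K j * a + rcomm (FreeAlgebra.ι K j) (FreeAlgebra.ι K i) * b,
        add_mem (ih hjL ha) (proper_mul_mem_orderedSpan hc (orderedSpan_erase_le j L hb)),
        FreeAlgebra.ι K j * b, ih hjL hb, ?_⟩
      simp only [rcomm]; noncomm_ring

lemma word_mem_orderedSpan {w L : List ℕ} (hw : w.Nodup) (h : w ⊆ L) :
    (w.map (FreeAlgebra.ι K)).prod ∈ orderedSpan K L := by
  induction w generalizing L with
  | nil => simpa using one_mem_orderedSpan L
  | cons j w ih =>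
    rw [List.nodup_cons] at hw
    rw [List.map_cons, List.prod_cons]
    refine ι_mul_mem_orderedSpan (h (by simp)) (ih hw.2 fun k hk => ?_)
    have hkj : k ≠ j := by rintro rfl; exact hw.1 hk
    exact (List.mem_erase_of_ne hkj).2 (h (by simp [hk]))

lemma diff_of_mem_orderedSpan {i : ℕ} {L : List ℕ} (hi : i ∉ L) {f : FreeAlgebra K ℕ}
    (hf : f ∈ orderedSpan K L) : diff K i f = 0 := by
  induction L generalizing f with
  | nil => exact diff_eq_zero_iff.2 (shift_of_mem_properSubalgebra i hf)
  | cons j L ih =>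
    rw [List.mem_cons, not_or] at hi
    obtain ⟨a, ha, b, hb, rfl⟩ := mem_orderedSpan_cons.1 hf
    rw [map_add, diff_ι_mul_of_ne (Ne.symm hi.1), ih hi.2 ha, ih hi.2 hb, mul_zero, add_zero]

lemma mem_properSubalgebra_of_diff_eq_zero {L : List ℕ} (hL : L.Nodup) {f : FreeAlgebra K ℕ}
    (hf : f ∈ orderedSpan K L) (h : ∀ i ∈ L, diff K i f = 0) : f ∈ properSubalgebra K := by
  induction L generalizing f with
  | nil => exact hf
  | cons i L ih =>
    rw [List.nodup_cons] at hL
    obtain ⟨a, ha, b, hb, rfl⟩ := mem_orderedSpan_cons.1 hf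
    have hb0 : b = 0 := by
      have := h i (by simp)
      rwa [map_add, diff_of_mem_orderedSpan hL.1 ha,
        diff_ι_mul_self (diff_of_mem_orderedSpan hL.1 hb), zero_add] at this
    subst hb0
    simp only [mul_zero, add_zero] at h ⊢
    exact ih hL.2 ha fun j hj => h j (by simp [hj])

variable (K) in
/-- The multilinear polynomials in the variables of `S` annihilated by the difference operators
of the variables of `R`. -/
def multilinKer (S R : Finset ℕ) : Submodule K (FreeAlgebra K ℕ) :=
  multilin K S ⊓ ⨅ i ∈ R, LinearMap.ker (diff K i)

lemma mem_multilinKer {S R : Finset ℕ} {f : FreeAlgebra K ℕ} :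
    f ∈ multilinKer K S R ↔ f ∈ multilin K S ∧ ∀ i ∈ R, diff K i f = 0 := by
  simp [multilinKer]

instance (S R : Finset ℕ) : FiniteDimensional K (multilinKer K S R) :=
  Submodule.finiteDimensional_of_le (inf_le_left : _ ≤ multilin K S)

lemma multilinKer_self (S : Finset ℕ) :
    multilinKer K S S = multilin K S ⊓ Subalgebra.toSubmodule (properSubalgebra K) := by
  ext f
  rw [mem_multilinKer, Submodule.mem_inf, Subalgebra.mem_toSubmodule]
  refine and_congr_right fun hf => ⟨fun h => ?_, fun h i _ =>
    diff_eq_zero_iff.2 (shift_of_mem_properSubalgebra i h)⟩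
  have hle : multilin K S ≤ orderedSpan K S.toList := by
    refine Submodule.span_le.2 ?_
    rintro _ ⟨l, hl, rfl, rfl⟩
    exact word_mem_orderedSpan hl fun k hk => by simpa using hk
  exact mem_properSubalgebra_of_diff_eq_zero (nodup_toList S) (hle hf) (by simpa using h)

lemma Gspace_eq_multilinKer (n : ℕ) : Gspace K n = multilinKer K (range n) (range n) := by
  rw [Gspace, Pspace_eq_multilin, multilinKer_self]

end Proper

section Dimensions

variable {K} (A : Type*) [Ring A] [Algebra K A]

lemma map_mem_Tideal (ψ : FreeAlgebra K ℕ →ₐ[K] FreeAlgebra K ℕ) {f : FreeAlgebra K ℕ}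
    (hf : f ∈ Tideal K A) : ψ f ∈ Tideal K A := by
  simp only [Tideal, Submodule.mem_iInf, LinearMap.mem_ker, AlgHom.toLinearMap_apply] at hf ⊢
  exact fun φ => hf (φ.comp ψ)

lemma mul_mem_Tideal (g : FreeAlgebra K ℕ) {f : FreeAlgebra K ℕ}
    (hf : f ∈ Tideal K A) : g * f ∈ Tideal K A := by
  simp only [Tideal, Submodule.mem_iInf, LinearMap.mem_ker, AlgHom.toLinearMap_apply] at hf ⊢
  intro φ
  rw [map_mul, hf φ, mul_zero]

lemma diff_mem_Tideal (i : ℕ) {f : FreeAlgebra K ℕ} (hf : f ∈ Tideal K A) :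
    diff K i f ∈ Tideal K A :=
  sub_mem (map_mem_Tideal A (shift K i) hf) hf

/-- The dimension of a subspace of the free algebra modulo the identities of `A`. -/
def dimMod (Q : Submodule K (FreeAlgebra K ℕ)) : ℕ :=
  Module.finrank K (Q.map (Tideal K A).mkQ)

lemma finrank_quotient_comap_eq_dimMod (Q : Submodule K (FreeAlgebra K ℕ)) :
    Module.finrank K (↥Q ⧸ (Tideal K A).comap Q.subtype) = dimMod A Q := by
  have hker : LinearMap.ker ((Tideal K A).mkQ ∘ₗ Q.subtype) =
      (Tideal K A).comap Q.subtype := by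
    rw [LinearMap.ker_comp, Submodule.ker_mkQ]
  have hrange : LinearMap.range ((Tideal K A).mkQ ∘ₗ Q.subtype) = Q.map (Tideal K A).mkQ := by
    rw [LinearMap.range_comp, Submodule.range_subtype]
  rw [dimMod, ← hker, ← hrange]
  exact ((Tideal K A).mkQ ∘ₗ Q.subtype).quotKerEquivRange.finrank_eq

lemma dimMod_multilinKer {S R : Finset ℕ} {i : ℕ} (hS : i ∈ S) (hR : i ∉ R) :
    dimMod A (multilinKer K S R) =
      dimMod A (multilinKer K (S.erase i) R) + dimMod A (multilinKer K S (insert i R)) := by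
  set T := Tideal K A
  let D : (FreeAlgebra K ℕ ⧸ T) →ₗ[K] (FreeAlgebra K ℕ ⧸ T) :=
    T.mapQ T (diff K i) fun f hf => diff_mem_Tideal A i hf
  have hD (f : FreeAlgebra K ℕ) : D (T.mkQ f) = T.mkQ (diff K i f) := rfl
  have hι {g : FreeAlgebra K ℕ} (hg : g ∈ multilinKer K (S.erase i) R) :
      FreeAlgebra.ι K i * g ∈ multilinKer K S R ∧ diff K i (FreeAlgebra.ι K i * g) = g := by
    rw [mem_multilinKer] at hg
    refine ⟨mem_multilinKer.2 ⟨?_, fun j hj => ?_⟩, diff_ι_mul_self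
      (diff_eq_zero_of_mem_multilin (notMem_erase i S) hg.1)⟩
    · simpa [insert_erase hS] using ι_mul_mem_multilin (notMem_erase i S) hg.1
    · rw [diff_ι_mul_of_ne (by rintro rfl; exact hR hj), hg.2 j hj, mul_zero]
  have hdiff {f : FreeAlgebra K ℕ} (hf : f ∈ multilinKer K S R) :
      diff K i f ∈ multilinKer K (S.erase i) R := by
    rw [mem_multilinKer] at hf ⊢
    exact ⟨diff_mem_multilin hS hf.1, fun j hj => by rw [diff_comm, hf.2 j hj, map_zero]⟩
  set Q := (multilinKer K S R).map T.mkQ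
  have hrange : LinearMap.range (D.domRestrict Q) =
      (multilinKer K (S.erase i) R).map T.mkQ := by
    rw [LinearMap.range_domRestrict]
    ext y
    constructor
    · rintro ⟨_, ⟨f, hf, rfl⟩, rfl⟩
      exact ⟨diff K i f, hdiff hf, rfl⟩
    · rintro ⟨g, hg, rfl⟩
      exact ⟨_, ⟨_, (hι hg).1, rfl⟩, by rw [hD, (hι hg).2]⟩
  have hker : (LinearMap.ker (D.domRestrict Q)).map Q.subtype =
      (multilinKer K S (insert i R)).map T.mkQ := by
    ext y
    constructor
    · rintro ⟨⟨_, f, hf, rfl⟩, hy, rfl⟩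
      have hT : diff K i f ∈ T := by
        have h0 : D (T.mkQ f) = 0 := hy
        rwa [hD, ← LinearMap.mem_ker, Submodule.ker_mkQ] at h0
      have hd := hι (hdiff hf)
      refine ⟨f - FreeAlgebra.ι K i * diff K i f, ?_, ?_⟩
      · have hsub := mem_multilinKer.1 (sub_mem hf hd.1)
        refine mem_multilinKer.2 ⟨hsub.1, fun j hj => ?_⟩
        rcases mem_insert.1 hj with rfl | hj
        · rw [map_sub, hd.2, sub_self]
        · exact hsub.2 j hj
      · have h0 : T.mkQ (FreeAlgebra.ι K i * diff K i f) = 0 := by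
          rw [← LinearMap.mem_ker, Submodule.ker_mkQ]
          exact mul_mem_Tideal A _ hT
        rw [map_sub, h0, sub_zero]
        rfl
    · rintro ⟨f, hf, rfl⟩
      rw [SetLike.mem_coe, mem_multilinKer] at hf
      refine ⟨⟨T.mkQ f, f, mem_multilinKer.2
        ⟨hf.1, fun j hj => hf.2 j (mem_insert_of_mem hj)⟩, rfl⟩, ?_, rfl⟩
      change D (T.mkQ f) = 0
      rw [hD, hf.2 i (mem_insert_self i R), map_zero]
  have key := LinearMap.finrank_range_add_finrank_ker (D.domRestrict Q)
  rw [hrange, ← Submodule.finrank_map_subtype_eq, hker] at key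
  exact key.symm

lemma dimMod_multilinKer_self_le {U V : Finset ℕ} (h : U.card = V.card) :
    dimMod A (multilinKer K V V) ≤ dimMod A (multilinKer K U U) := by
  obtain ⟨g, hg⟩ : ∃ g : ℕ → ℕ, Set.BijOn g U V :=
    U.finite_toSet.exists_bijOn_of_encard_eq (by simp [h])
  have hinv := hg.invOn_invFunOn
  set k := Function.invFunOn g (U : Set ℕ)
  have hk : Set.BijOn k V U := (Set.InvOn.bijOn hinv.symm (hg.surjOn.mapsTo_invFunOn) hg.mapsTo)
  have hkU : V.image k = U := by
    apply Finset.coe_injective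
    rw [coe_image, hk.image_eq]
  set T := Tideal K A
  let G : (FreeAlgebra K ℕ ⧸ T) →ₗ[K] (FreeAlgebra K ℕ ⧸ T) :=
    T.mapQ T (rename K g).toLinearMap fun f hf => map_mem_Tideal A _ hf
  have hle : (multilinKer K V V).map T.mkQ ≤ ((multilinKer K U U).map T.mkQ).map G := by
    rintro _ ⟨f, hf, rfl⟩
    rw [SetLike.mem_coe, multilinKer_self, Submodule.mem_inf] at hf
    refine ⟨_, ⟨rename K k f, ?_, rfl⟩, ?_⟩
    · rw [SetLike.mem_coe, multilinKer_self]
      refine ⟨?_, rename_mem_properSubalgebra k hf.2⟩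
      have := rename_mem_multilin hk.injOn hf.1
      rwa [hkU] at this
    · change T.mkQ (rename K g (rename K k f)) = _
      rw [rename_rename_of_mem_multilin (fun i hi => hinv.2 (mem_coe.2 hi)) hf.1]
  exact (Submodule.finrank_mono hle).trans (Submodule.finrank_map_le _ _)

lemma dimMod_multilinKer_self (U : Finset ℕ) :
    dimMod A (multilinKer K U U) = properCodim K A U.card := by
  rw [properCodim, finrank_quotient_comap_eq_dimMod, Gspace_eq_multilinKer]
  exact le_antisymm (dimMod_multilinKer_self_le A (by simp))
    (dimMod_multilinKer_self_le A (by simp))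

lemma dimMod_multilinKer_union {R D : Finset ℕ} (h : Disjoint R D) :
    dimMod A (multilinKer K (R ∪ D) R) =
      ∑ U ∈ D.powerset, dimMod A (multilinKer K (R ∪ U) (R ∪ U)) := by
  induction D using Finset.induction_on generalizing R with
  | empty => simp
  | insert i D hi ih =>
    rw [disjoint_insert_right] at h
    have herase : (R ∪ insert i D).erase i = R ∪ D := by
      rw [union_insert, erase_insert (by simp [h.1, hi])]
    have hunion (U : Finset ℕ) : R ∪ insert i U = insert i R ∪ U := by
      rw [union_insert, insert_union]
    rw [dimMod_multilinKer A (i := i) (by simp) h.1, herase, ih h.2, sum_powerset_insert hi,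
      hunion, ih (disjoint_insert_left.2 ⟨hi, h.2⟩)]
    simp only [hunion]

end Dimensions

/-- For a unital PI-algebra `A` over a field of characteristic zero,
`c_n(A) = Σ_{l=0}^{n} C(n,l) γ_l(A)`. -/
theorem stmt_16 [CharZero K] (A : Type*) [Ring A] [Algebra K A]
    (hPI : ∃ f ∈ Tideal K A, f ≠ 0) (n : ℕ) :
    codim K A n = ∑ l ∈ Finset.range (n + 1), n.choose l * properCodim K A l := by
  have h0 : multilinKer K (range n) ∅ = Pspace K n := by
    ext f
    simp [mem_multilinKer, Pspace_eq_multilin]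
  have h := dimMod_multilinKer_union (K := K) A (disjoint_empty_left (range n))
  simp only [empty_union, h0, dimMod_multilinKer_self] at h
  rw [codim, finrank_quotient_comap_eq_dimMod, h,
    sum_powerset_apply_card (fun l => properCodim K A l), card_range]
  simp only [smul_eq_mul]

end
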